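/- arXiv:2211.05266 — 4 statements merged into one kernel-verified Lean document; each statement's English description precedes it below -/
import Mathlib

section
/- Suppose (g_1,…,g_{n-1}) is strongly monotone on B. Then for any two distinct points p, q ∈ S ∩ B, for all indices i, j ∈ {1,…,n}, every admissible i-minor M_i and every admissible j-minor M_j of (g_1,…,g_{n-1}) over B, one has ((p_i − q_i)·(−1)^{i+1}·det M_i) · ((p_j − q_j)·(−1)^{j+1}·det M_j) > 0. (In particular, taking i = j, p and q differ in every coordinate.) -/
/-- The partial derivative `∂f/∂x_i` at `p`. -/
noncomputable def pd {m : ℕ} (f : (Fin m → ℝ) → ℝ) (i : Fin m) (p : Fin m → ℝ) : ℝ :=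
  fderiv ℝ f p (Pi.single i 1)

/-- `f` is continuously differentiable on an open set containing `B`. -/
def C1On {m : ℕ} (f : (Fin m → ℝ) → ℝ) (B : Set (Fin m → ℝ)) : Prop :=
  ∃ U : Set (Fin m → ℝ), IsOpen U ∧ B ⊆ U ∧ ContDiffOn ℝ 1 f U

/-- `M` is an admissible `i`-minor of the family `g = (g_1, …, g_{n+1})` of
functions on `ℝ^{n+2}` over `B`: there are points `q j ∈ B` with
`M j k = (∂ g_j / ∂ x_{c k})(q j)`, where `c = i.succAbove` is the increasing
enumeration of the complement of `{i}` in `Fin (n+2)`. -/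
def AdmMinor (n : ℕ) (g : Fin (n+1) → (Fin (n+2) → ℝ) → ℝ) (B : Set (Fin (n+2) → ℝ))
    (i : Fin (n+2)) (M : Matrix (Fin (n+1)) (Fin (n+1)) ℝ) : Prop :=
  ∃ q : Fin (n+1) → (Fin (n+2) → ℝ), (∀ j, q j ∈ B) ∧
    ∀ j k, M j k = pd (g j) (i.succAbove k) (q j)

/-- The family `(g_1, …, g_{n+1})` is strongly monotone on `B`: every admissible
`i`-minor over `B` has nonzero determinant, for every `i`. -/
def StrongMono (n : ℕ) (g : Fin (n+1) → (Fin (n+2) → ℝ) → ℝ)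
    (B : Set (Fin (n+2) → ℝ)) : Prop :=
  ∀ (i : Fin (n+2)) (M : Matrix (Fin (n+1)) (Fin (n+1)) ℝ), AdmMinor n g B i M → M.det ≠ 0

open Set

/-- The cofactor row of a `k × (k+1)` matrix: the entry at `i` is the signed minor that omits
column `i`. -/
noncomputable def cofactorRow {k : ℕ} (A : Matrix (Fin k) (Fin (k+1)) ℝ) (i : Fin (k+1)) : ℝ :=
  (-1) ^ (i : ℕ) * (A.submatrix id i.succAbove).det

theorem det_vecCons_eq_dotProduct_cofactorRow {k : ℕ} (A : Matrix (Fin k) (Fin (k+1)) ℝ)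
    (r : Fin (k+1) → ℝ) :
    (Matrix.of (Matrix.vecCons r A) : Matrix (Fin (k+1)) (Fin (k+1)) ℝ).det
      = r ⬝ᵥ cofactorRow A := by
  rw [Matrix.det_succ_row_zero]
  refine Finset.sum_congr rfl fun i _ => ?_
  have h : (Matrix.of (Matrix.vecCons r A)).submatrix Fin.succ i.succAbove
      = A.submatrix id i.succAbove := by
    ext x y
    rfl
  rw [h, cofactorRow, Matrix.of_apply]
  change _ * r i * _ = _
  ring

/-- A kernel vector of a `k × (k+1)` matrix is proportional to its cofactor row. -/
theorem mul_cofactorRow_comm_of_mulVec_eq_zero {k : ℕ} (A : Matrix (Fin k) (Fin (k+1)) ℝ)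
    (v : Fin (k+1) → ℝ) (hv : v ≠ 0) (hA : A.mulVec v = 0) (i j : Fin (k+1)) :
    v i * cofactorRow A j = v j * cofactorRow A i := by
  set r : Fin (k+1) → ℝ := v i • Pi.single j 1 - v j • Pi.single i 1 with hr
  have hdet : (Matrix.of (Matrix.vecCons r A) : Matrix (Fin (k+1)) (Fin (k+1)) ℝ).det = 0 := by
    refine Matrix.exists_mulVec_eq_zero_iff.mp ⟨v, hv, ?_⟩
    ext x
    refine Fin.cases ?_ (fun y => ?_) x
    · change r ⬝ᵥ v = 0
      rw [hr, sub_dotProduct, smul_dotProduct, smul_dotProduct, single_one_dotProduct,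
        single_one_dotProduct, smul_eq_mul, smul_eq_mul]
      ring
    · exact congrFun hA y
  rw [det_vecCons_eq_dotProduct_cofactorRow, hr, sub_dotProduct, smul_dotProduct, smul_dotProduct,
    single_one_dotProduct, single_one_dotProduct] at hdet
  exact sub_eq_zero.mp hdet

theorem C1On.continuousOn_pd {m : ℕ} {f : (Fin m → ℝ) → ℝ} {B : Set (Fin m → ℝ)}
    (hf : C1On f B) (i : Fin m) : ContinuousOn (pd f i) B := by
  obtain ⟨U, hU, hBU, h⟩ := hf
  exact ((h.continuousOn_fderiv_of_isOpen hU le_rfl).mono hBU).clm_apply continuousOn_const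

theorem C1On.differentiableAt {m : ℕ} {f : (Fin m → ℝ) → ℝ} {B : Set (Fin m → ℝ)}
    (hf : C1On f B) {x : Fin m → ℝ} (hx : x ∈ B) : DifferentiableAt ℝ f x := by
  obtain ⟨U, hU, hBU, h⟩ := hf
  exact (h.differentiableOn one_ne_zero).differentiableAt (hU.mem_nhds (hBU hx))

/-- Mean value theorem, with the derivative written through partial derivatives. -/
theorem C1On.exists_pd_dotProduct_eq_sub {m : ℕ} {f : (Fin m → ℝ) → ℝ} {B : Set (Fin m → ℝ)}
    (hf : C1On f B) (hB : Convex ℝ B) {p q : Fin m → ℝ} (hp : p ∈ B) (hq : q ∈ B) :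
    ∃ z ∈ B, (fun i => pd f i z) ⬝ᵥ (p - q) = f p - f q := by
  obtain ⟨z, hz, h⟩ := domain_mvt (f := f) (f' := fderiv ℝ f) (s := B) (x := q) (y := p)
    (fun x hx => (hf.differentiableAt hx).hasFDerivAt.hasFDerivWithinAt) hB hq hp
  refine ⟨z, hB.segment_subset hq hp hz, ?_⟩
  rw [h, ← ContinuousLinearMap.coe_coe, LinearMap.pi_apply_eq_sum_univ]
  refine Finset.sum_congr rfl fun i _ => ?_
  have hsingle : (Pi.single i 1 : Fin m → ℝ) = fun j => if i = j then 1 else 0 := by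
    ext j
    simp [Pi.single_apply, eq_comm]
  rw [← hsingle]
  exact mul_comm _ _

/-- All admissible `i`-minors of a strongly monotone family have the same sign. -/
theorem StrongMono.det_mul_det_pos {n : ℕ} {g : Fin (n+1) → (Fin (n+2) → ℝ) → ℝ}
    {B : Set (Fin (n+2) → ℝ)} (hSM : StrongMono n g B) (hC1 : ∀ j, C1On (g j) B)
    (hB : Convex ℝ B) {i : Fin (n+2)} {M N : Matrix (Fin (n+1)) (Fin (n+1)) ℝ}
    (hM : AdmMinor n g B i M) (hN : AdmMinor n g B i N) : 0 < M.det * N.det := by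
  obtain ⟨x, hx, hMx⟩ := hM
  obtain ⟨y, hy, hNy⟩ := hN
  let J : (Fin (n+1) → Fin (n+2) → ℝ) → Matrix (Fin (n+1)) (Fin (n+1)) ℝ :=
    fun z => Matrix.of fun j k => pd (g j) (i.succAbove k) (z j)
  have hMJ : M = J x := Matrix.ext hMx
  have hNJ : N = J y := Matrix.ext hNy
  let T : Set (Fin (n+1) → Fin (n+2) → ℝ) := univ.pi fun _ => B
  have hT : Convex ℝ T := convex_pi fun _ _ => hB
  have hcont : ContinuousOn (fun z => (J z).det) T := by
    have hJ : ContinuousOn J T := by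
      refine continuousOn_pi.mpr fun j => continuousOn_pi.mpr fun k => ?_
      exact ((hC1 j).continuousOn_pd _).comp (continuous_apply j).continuousOn
        fun z hz => hz j (mem_univ j)
    exact (continuous_id.matrix_det).comp_continuousOn hJ
  by_contra! hle
  have hmem : (0 : ℝ) ∈ uIcc (J x).det (J y).det := by
    rw [hMJ, hNJ] at hle
    rw [mem_uIcc]
    rcases mul_nonpos_iff.mp hle with h | h
    · exact Or.inr h.symm
    · exact Or.inl h
  obtain ⟨z, hz, hz0⟩ := (hT.isPreconnected.image _ hcont).ordConnected.uIcc_subset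
    (mem_image_of_mem _ fun j _ => hx j) (mem_image_of_mem _ fun j _ => hy j) hmem
  exact hSM i (J z) ⟨z, fun j => hz j (mem_univ j), fun _ _ => rfl⟩ hz0

/-- If `(g_1,…,g_{n-1})` is strongly monotone on `B`, then for distinct
`p, q ∈ S ∩ B`, all indices `i, j`, every admissible `i`-minor `Mi` and
`j`-minor `Mj`, the products `(p_i − q_i)·(−1)^{i+1}·det Mi` and
`(p_j − q_j)·(−1)^{j+1}·det Mj` have the same (nonzero) sign.
(Indices here are 0-based, so the paper's `(−1)^{i+1}` is `(−1)^{i.val}`.) -/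
theorem matched_diffs_of_strongMono (n : ℕ) (a b : Fin (n+2) → ℝ)
    (hab : ∀ i, a i < b i) (g : Fin (n+1) → (Fin (n+2) → ℝ) → ℝ)
    (hC1 : ∀ j, C1On (g j) (Set.Icc a b))
    (hSM : StrongMono n g (Set.Icc a b)) :
    ∀ p q : Fin (n+2) → ℝ, p ∈ Set.Icc a b → q ∈ Set.Icc a b → p ≠ q →
      (∀ j, g j p = 0) → (∀ j, g j q = 0) →
      ∀ (i j : Fin (n+2)) (Mi Mj : Matrix (Fin (n+1)) (Fin (n+1)) ℝ),
        AdmMinor n g (Set.Icc a b) i Mi → AdmMinor n g (Set.Icc a b) j Mj →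
        ((p i - q i) * (-1 : ℝ) ^ (i : ℕ) * Mi.det) *
          ((p j - q j) * (-1 : ℝ) ^ (j : ℕ) * Mj.det) > 0 := by
  intro p q hp hq hpq hgp hgq i j Mi Mj hMi hMj
  have hB : Convex ℝ (Icc a b) := convex_Icc a b
  choose z hz hzmean using fun l => (hC1 l).exists_pd_dotProduct_eq_sub hB hp hq
  let A : Matrix (Fin (n+1)) (Fin (n+2)) ℝ := Matrix.of fun l k => pd (g l) k (z l)
  have hA : A.mulVec (p - q) = 0 := by
    ext l
    exact (hzmean l).trans (by rw [hgp, hgq, sub_zero]; rfl)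
  have hadm (l : Fin (n+2)) : AdmMinor n g (Icc a b) l (A.submatrix id l.succAbove) :=
    ⟨z, hz, fun _ _ => rfl⟩
  have hv : p - q ≠ 0 := sub_ne_zero.mpr hpq
  have hcof (l : Fin (n+2)) : cofactorRow A l ≠ 0 :=
    mul_ne_zero (pow_ne_zero _ (by norm_num)) (hSM l _ (hadm l))
  obtain ⟨c, hc⟩ : ∃ c : ℝ, ∀ l, p l - q l = c * cofactorRow A l := by
    refine ⟨(p i - q i) / cofactorRow A i, fun l => ?_⟩
    rw [div_mul_eq_mul_div, eq_div_iff (hcof i)]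
    exact mul_cofactorRow_comm_of_mulVec_eq_zero A _ hv hA l i
  have hc0 : c ≠ 0 := by
    rintro rfl
    exact hv (funext fun l => by simpa using hc l)
  have hsign (l : Fin (n+2)) (M : Matrix (Fin (n+1)) (Fin (n+1)) ℝ) :
      (p l - q l) * (-1 : ℝ) ^ (l : ℕ) * M.det
        = c * ((A.submatrix id l.succAbove).det * M.det) := by
    have hsq : (-1 : ℝ) ^ (l : ℕ) * (-1) ^ (l : ℕ) = 1 := by
      rw [← mul_pow]; simp
    rw [hc l, cofactorRow]
    linear_combination c * (A.submatrix id l.succAbove).det * M.det * hsq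
  rw [hsign, hsign, mul_mul_mul_comm]
  exact mul_pos (mul_self_pos.mpr hc0) (mul_pos (hSM.det_mul_det_pos hC1 hB (hadm i) hMi)
    (hSM.det_mul_det_pos hC1 hB (hadm j) hMj))
end

section
/- If F = (f_1,…,f_n) is an O-M system on B, then F has at most one zero in B: there is at most one point p ∈ B with f_1(p) = ⋯ = f_n(p) = 0. -/
/-- `F = (f_1,…,f_n)` (with `n = n'+2`, 0-based indices) is an O-M system on `B`:
(1) the first `n-1` components are strongly monotone on `B`, and (2) for all
indices `i, j`, admissible minors `Mi, Mj` of the first `n-1` components, and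
points `p, q ∈ B`, the quantities `(−1)^{i+n}·det Mi·(∂f_n/∂x_i)(p)` and
`(−1)^{j+n}·det Mj·(∂f_n/∂x_j)(q)` have the same (nonzero) sign.  With 0-based
indices the paper's exponent `i+n` becomes `i.val + n' + 1 (mod 2)`. -/
def OMSystem (n : ℕ) (f : Fin (n+2) → (Fin (n+2) → ℝ) → ℝ)
    (B : Set (Fin (n+2) → ℝ)) : Prop :=
  StrongMono n (fun j : Fin (n+1) => f j.castSucc) B ∧
  ∀ (i j : Fin (n+2)) (Mi Mj : Matrix (Fin (n+1)) (Fin (n+1)) ℝ),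
    AdmMinor n (fun j : Fin (n+1) => f j.castSucc) B i Mi →
    AdmMinor n (fun j : Fin (n+1) => f j.castSucc) B j Mj →
    ∀ p q : Fin (n+2) → ℝ, p ∈ B → q ∈ B →
      ((-1 : ℝ) ^ ((i : ℕ) + n + 1) * Mi.det * pd (f (Fin.last (n+1))) i p) *
        ((-1 : ℝ) ^ ((j : ℕ) + n + 1) * Mj.det * pd (f (Fin.last (n+1))) j q) > 0

/-- Mean value theorem on a convex set, with the derivative written through partial derivatives. -/
theorem C1On.exists_sub_eq_sum_pd {m : ℕ} {f : (Fin m → ℝ) → ℝ} {B : Set (Fin m → ℝ)}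
    (hf : C1On f B) (hB : Convex ℝ B) {p q : Fin m → ℝ} (hp : p ∈ B) (hq : q ∈ B) :
    ∃ z ∈ B, f q - f p = ∑ i, pd f i z * (q - p) i := by
  obtain ⟨U, hU, hBU, hfU⟩ := hf
  obtain ⟨z, hz, h⟩ := domain_mvt (f := f) (f' := fderiv ℝ f) (s := B)
    (fun x hx => (((hfU.contDiffAt (hU.mem_nhds (hBU hx))).differentiableAt
      one_ne_zero).hasFDerivAt).hasFDerivWithinAt) hB hp hq
  refine ⟨z, hB.segment_subset hp hq hz, h.trans ?_⟩
  conv_lhs => rw [pi_eq_sum_univ' (q - p), map_sum]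
  refine Finset.sum_congr rfl fun i _ => ?_
  rw [map_smul, smul_eq_mul, mul_comm, pd]

/-- For an O-M system, a matrix whose rows are gradients of the components at possibly
different points of `B` is nonsingular. -/
theorem OMSystem.det_ne_zero {n : ℕ} {f : Fin (n+2) → (Fin (n+2) → ℝ) → ℝ}
    {B : Set (Fin (n+2) → ℝ)} (hOM : OMSystem n f B) {z : Fin (n+2) → Fin (n+2) → ℝ}
    (hz : ∀ j, z j ∈ B) : (Matrix.of fun j i => pd (f j) i (z j)).det ≠ 0 := by
  set A : Matrix (Fin (n+2)) (Fin (n+2)) ℝ := Matrix.of fun j i => pd (f j) i (z j) with hA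
  let M (i : Fin (n+2)) := A.submatrix Fin.castSucc i.succAbove
  have hM (i) : AdmMinor n (fun j : Fin (n+1) => f j.castSucc) B i (M i) :=
    ⟨fun j => z j.castSucc, fun j => hz _, fun j k => rfl⟩
  let t (i : Fin (n+2)) : ℝ :=
    (-1) ^ ((i : ℕ) + n + 1) * (M i).det * pd (f (Fin.last (n+1))) i (z (Fin.last (n+1)))
  have ht (i j) : 0 < t i * t j := hOM.2 i j _ _ (hM i) (hM j) _ _ (hz _) (hz _)
  have hdet : A.det = ∑ i, t i := by
    rw [Matrix.det_succ_row A (Fin.last (n+1))]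
    refine Finset.sum_congr rfl fun i _ => ?_
    simp only [t, M, Fin.succAbove_last, Fin.val_last]
    rw [hA, Matrix.of_apply]
    ring
  have hpos : 0 < t 0 * A.det := by
    rw [hdet, Finset.mul_sum]
    exact Finset.sum_pos (fun i _ => ht 0 i) Finset.univ_nonempty
  exact right_ne_zero_of_mul hpos.ne'

/-- An O-M system on a box `B` has at most one zero in `B`. -/
theorem OMSystem.at_most_one_zero (n : ℕ) (a b : Fin (n+2) → ℝ)
    (hab : ∀ i, a i < b i) (f : Fin (n+2) → (Fin (n+2) → ℝ) → ℝ)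
    (hC1 : ∀ j, C1On (f j) (Set.Icc a b))
    (hOM : OMSystem n f (Set.Icc a b)) :
    ∀ p q : Fin (n+2) → ℝ, p ∈ Set.Icc a b → q ∈ Set.Icc a b →
      (∀ j, f j p = 0) → (∀ j, f j q = 0) → p = q := by
  intro p q hp hq hfp hfq
  choose z hz h using fun j => (hC1 j).exists_sub_eq_sum_pd (convex_Icc a b) hp hq
  have hker : (Matrix.of fun j i => pd (f j) i (z j)).mulVec (q - p) = 0 := by
    ext j
    simpa [hfp, hfq, Matrix.mulVec, dotProduct] using (h j).symm
  exact (sub_eq_zero.mp (Matrix.eq_zero_of_mulVec_eq_zero (hOM.det_ne_zero hz) hker)).symm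
end

section
/- (Jacobian test.) Let g_1, …, g_n : (Fin n → ℝ) → ℝ be C¹ on B. Suppose that for every choice of points q_1, …, q_n ∈ B, the n×n real matrix whose j-th row is the gradient ∇g_j(q_j) (i.e. with (j,k)-entry (∂g_j/∂x_k)(q_j)) has nonzero determinant. Then the system has at most one common zero in B: there is at most one point p ∈ B with g_1(p) = ⋯ = g_n(p) = 0. -/
/-- The derivative of `f` at `p` is the linear form given by the partial derivatives. -/
theorem fderiv_apply_eq_sum_pd {m : ℕ} (f : (Fin m → ℝ) → ℝ) (p v : Fin m → ℝ) :
    fderiv ℝ f p v = ∑ k, pd f k p * v k := by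
  rw [← ContinuousLinearMap.coe_coe, LinearMap.pi_apply_eq_sum_univ]
  refine Finset.sum_congr rfl fun k _ => ?_
  simp only [pd, smul_eq_mul, mul_comm, ContinuousLinearMap.coe_coe]
  congr 2
  ext j
  simp [Pi.single_apply, eq_comm]

/-- Mean value theorem on a convex set, for a function that is `C¹` near it. -/
theorem C1On.exists_sub_eq_fderiv {m : ℕ} {f : (Fin m → ℝ) → ℝ} {B : Set (Fin m → ℝ)}
    (hf : C1On f B) (hB : Convex ℝ B) {p q : Fin m → ℝ} (hp : p ∈ B) (hq : q ∈ B) :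
    ∃ z ∈ B, f q - f p = fderiv ℝ f z (q - p) := by
  obtain ⟨U, hU, hBU, hfU⟩ := hf
  have hder : ∀ x ∈ B, HasFDerivWithinAt f (fderiv ℝ f x) B x := fun x hx =>
    ((hfU.differentiableOn one_ne_zero).differentiableAt
      (hU.mem_nhds (hBU hx))).hasFDerivAt.hasFDerivWithinAt
  obtain ⟨z, hz, h⟩ := domain_mvt hder hB hp hq
  exact ⟨z, hB.segment_subset hp hq hz, h⟩

/-- Jacobian test: if for every choice of points `q_1,…,q_n ∈ B` the matrix with
`(j,k)`-entry `(∂g_j/∂x_k)(q_j)` has nonzero determinant, then the system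
`g_1 = ⋯ = g_n = 0` has at most one solution in `B`. -/
theorem jacobian_test (n : ℕ) (a b : Fin (n+1) → ℝ) (hab : ∀ i, a i < b i)
    (g : Fin (n+1) → (Fin (n+1) → ℝ) → ℝ)
    (hC1 : ∀ j, C1On (g j) (Set.Icc a b))
    (hJ : ∀ q : Fin (n+1) → (Fin (n+1) → ℝ), (∀ j, q j ∈ Set.Icc a b) →
      (Matrix.of fun j k : Fin (n+1) => pd (g j) k (q j)).det ≠ 0) :
    ∀ p q : Fin (n+1) → ℝ, p ∈ Set.Icc a b → q ∈ Set.Icc a b →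
      (∀ j, g j p = 0) → (∀ j, g j q = 0) → p = q := by
  intro p q hp hq hgp hgq
  choose z hz h using fun j => (hC1 j).exists_sub_eq_fderiv (convex_Icc a b) hp hq
  refine (sub_eq_zero.1 (Matrix.eq_zero_of_mulVec_eq_zero (hJ z hz) ?_)).symm
  ext j
  have hj := h j
  rw [hgp, hgq, sub_zero, fderiv_apply_eq_sum_pd] at hj
  exact hj.symm
end

section
/- (Preconditioner, S-M version.) Let Ω ⊆ ℝⁿ be open, F = (f_1,…,f_n) with each f_j : (Fin n → ℝ) → ℝ continuously differentiable on Ω, and let p* ∈ Ω be a simple zero of F, i.e. F(p*) = 0 and det J_F(p*) ≠ 0, where J_F(x) is the Jacobian matrix with (j,k)-entry (∂f_j/∂x_k)(x). Let V be a fixed real n×n S-M matrix. Then there exists δ > 0 such that for every box B = Set.Icc a b with a i < b i for all i, p* ∈ B, B ⊆ Ω, and max_i (b i − a i) < δ, the matrix J_F(m) at the midpoint m = (a+b)/2 of B is invertible and the transformed system G with components G_k(x) = Σ_l (V · J_F(m)⁻¹)_{k,l} · f_l(x) is an S-M system on B. -/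
/-- `F = (f_1,…,f_m)` is an S-M system on `B ⊆ ℝ^m`: for every `k ∈ {1,…,m}`,
every strictly increasing choice of `k` column indices `c`, and all points
`q_1,…,q_k ∈ B`, the `k × k` matrix with `(j,l)`-entry `(∂f_j/∂x_{c l})(q j)`
has nonzero determinant.  (`k` is represented as `k'+1` with `k'+1 ≤ m`.) -/
def SMSystem (m : ℕ) (f : Fin m → (Fin m → ℝ) → ℝ) (B : Set (Fin m → ℝ)) : Prop :=
  ∀ (k : ℕ) (hk : k + 1 ≤ m) (c : Fin (k+1) → Fin m), StrictMono c →
    ∀ q : Fin (k+1) → (Fin m → ℝ), (∀ j, q j ∈ B) →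
      (Matrix.of fun j l : Fin (k+1) => pd (f (Fin.castLE hk j)) (c l) (q j)).det ≠ 0

/-- `V` is an S-M matrix: for every `k ∈ {1,…,m}` and every strictly increasing
choice of `k` column indices, the `k × k` submatrix of `V` formed by its first
`k` rows and those columns has nonzero determinant. -/
def SMMatrix (m : ℕ) (V : Matrix (Fin m) (Fin m) ℝ) : Prop :=
  ∀ (k : ℕ) (hk : k + 1 ≤ m) (c : Fin (k+1) → Fin m), StrictMono c →
    (Matrix.of fun j l : Fin (k+1) => V (Fin.castLE hk j) (c l)).det ≠ 0

open Filter Topology in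
/-- Near a point where a continuous function of finitely many copies of the variable is nonzero,
it stays nonzero uniformly for all arguments in a small ball. -/
theorem eventually_ne_zero_of_mem_ball {X κ : Type*} [PseudoMetricSpace X] [Fintype κ]
    {p : X} {g : X × (κ → X) → ℝ} (hg : ContinuousAt g (p, fun _ => p))
    (h0 : g (p, fun _ => p) ≠ 0) :
    ∀ᶠ δ : ℝ in 𝓝[>] 0, ∀ x q, dist x p < δ → (∀ j, dist (q j) p < δ) → g (x, q) ≠ 0 := by
  obtain ⟨ε, hε, h⟩ := Metric.eventually_nhds_iff.mp (hg.eventually_ne h0)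
  filter_upwards [Ioo_mem_nhdsGT hε] with δ hδ x q hx hq
  refine h ?_
  rw [Prod.dist_eq, max_lt_iff]
  exact ⟨hx.trans hδ.2, (dist_pi_lt_iff hε).mpr fun j => (hq j).trans hδ.2⟩

/-- A partial derivative of a `C¹` function is continuous at every point of the open domain. -/
theorem continuousAt_pd {m : ℕ} {f : (Fin m → ℝ) → ℝ} {Ω : Set (Fin m → ℝ)} (hΩ : IsOpen Ω)
    (hf : ContDiffOn ℝ 1 f Ω) {p : Fin m → ℝ} (hp : p ∈ Ω) (i : Fin m) :
    ContinuousAt (pd f i) p :=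
  ((hf.continuousOn_fderiv_of_isOpen hΩ le_rfl).continuousAt (hΩ.mem_nhds hp)).clm_apply
    continuousAt_const

/-- Partial derivatives commute with finite linear combinations. -/
theorem pd_sum_mul {m : ℕ} {ι : Type*} [Fintype ι] (w : ι → ℝ) {f : ι → (Fin m → ℝ) → ℝ}
    {x : Fin m → ℝ} (hf : ∀ l, DifferentiableAt ℝ (f l) x) (i : Fin m) :
    pd (fun x => ∑ l, w l * f l x) i x = ∑ l, w l * pd (f l) i x := by
  unfold pd
  rw [fderiv_fun_sum fun l _ => (hf l).const_mul (w l), sum_apply]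
  simp [fderiv_const_mul (hf _)]

/-- Preconditioner, S-M version: near a simple zero `p` of `F`, for every small
enough box `B ∋ p` the system `G = V · J_F(m(B))⁻¹ · F` is an S-M system on `B`. -/
theorem preconditioner_SM (n : ℕ) (Ω : Set (Fin (n+1) → ℝ)) (hΩ : IsOpen Ω)
    (f : Fin (n+1) → (Fin (n+1) → ℝ) → ℝ)
    (hC1 : ∀ j, ContDiffOn ℝ 1 (f j) Ω)
    (p : Fin (n+1) → ℝ) (hp : p ∈ Ω) (hzero : ∀ j, f j p = 0)
    (hsimple : (Matrix.of fun j k : Fin (n+1) => pd (f j) k p).det ≠ 0)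
    (V : Matrix (Fin (n+1)) (Fin (n+1)) ℝ) (hV : SMMatrix (n+1) V) :
    ∃ δ > 0, ∀ a b : Fin (n+1) → ℝ, (∀ i, a i < b i) →
      p ∈ Set.Icc a b → Set.Icc a b ⊆ Ω → (∀ i, b i - a i < δ) →
      IsUnit (Matrix.of fun j k : Fin (n+1) => pd (f j) k (fun i => (a i + b i) / 2)) ∧
      SMSystem (n+1)
        (fun k x => ∑ l,
          (V * (Matrix.of fun j k' : Fin (n+1) =>
              pd (f j) k' (fun i => (a i + b i) / 2))⁻¹) k l * f l x)
        (Set.Icc a b) := by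
  classical
  set J : (Fin (n+1) → ℝ) → Matrix (Fin (n+1)) (Fin (n+1)) ℝ :=
    fun x => Matrix.of fun j k => pd (f j) k x with hJ
  have hpd : ∀ j k, ContinuousAt (pd (f j) k) p := fun j k => continuousAt_pd hΩ (hC1 j) hp k
  have hJc : ContinuousAt J p :=
    continuousAt_pi.mpr fun j => continuousAt_pi.mpr fun k => hpd j k
  have hdet : ContinuousAt (fun x => (J x).det) p :=
    (Continuous.matrix_det continuous_id).continuousAt.comp hJc
  have hJinv : ContinuousAt (fun x => (J x)⁻¹) p := by
    have hadj : ContinuousAt (fun x => (J x).adjugate) p :=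
      (Continuous.matrix_adjugate continuous_id).continuousAt.comp hJc
    simp only [Matrix.inv_def, Ring.inverse_eq_inv']
    exact (hdet.inv₀ hsimple).smul hadj
  have hW : ContinuousAt (fun x => V * (J x)⁻¹) p :=
    (continuous_const.matrix_mul continuous_id).continuousAt.comp hJinv
  have hminors : ∀ᶠ δ : ℝ in nhdsWithin 0 (Set.Ioi 0), ∀ (k : Fin (n+1))
      (c : Fin (k+1) → Fin (n+1)), StrictMono c → ∀ x (q : Fin (k+1) → Fin (n+1) → ℝ),
      dist x p < δ → (∀ j, dist (q j) p < δ) →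
      (Matrix.of fun j l : Fin (k+1) => ∑ i,
        (V * (J x)⁻¹) (Fin.castLE k.isLt j) i * pd (f i) (c l) (q j)).det ≠ 0 := by
    refine Filter.eventually_all.mpr fun k => Filter.eventually_all.mpr fun c =>
      Filter.eventually_imp_distrib_left.mpr fun hc => ?_
    refine eventually_ne_zero_of_mem_ball (p := p)
      (g := fun z : (Fin (n+1) → ℝ) × (Fin (k+1) → Fin (n+1) → ℝ) =>
        (Matrix.of fun j l : Fin (k+1) => ∑ i,
          (V * (J z.1)⁻¹) (Fin.castLE k.isLt j) i * pd (f i) (c l) (z.2 j)).det) ?_ ?_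
    · refine (Continuous.matrix_det continuous_id).continuousAt.comp
        (continuousAt_pi.mpr fun j => continuousAt_pi.mpr fun l => ?_)
      refine tendsto_finsetSum (Finset.univ : Finset (Fin (n+1))) fun i _ =>
        Filter.Tendsto.mul ?_ ?_
      · exact (continuousAt_pi.mp (continuousAt_pi.mp hW (Fin.castLE k.isLt j)) i).tendsto.comp
          continuous_fst.continuousAt
      · exact (hpd i (c l)).tendsto.comp
          ((continuous_apply j).comp continuous_snd).continuousAt
    · have hmul : V * (J p)⁻¹ * J p = V :=
        Matrix.nonsing_inv_mul_cancel_right _ _ (isUnit_iff_ne_zero.mpr hsimple)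
      have hentry : ∀ i j, ∑ s, (V * (J p)⁻¹) i s * pd (f s) j p = V i j := fun i j => by
        conv_rhs => rw [← hmul]
        exact (Matrix.mul_apply).symm
      simp only [hentry]
      exact hV k k.isLt c hc
  obtain ⟨ε, hε, hunit⟩ := Metric.eventually_nhds_iff.mp (hdet.eventually_ne hsimple)
  obtain ⟨δ, hδ, hδm⟩ := ((Filter.eventually_mem_set.mpr (Ioo_mem_nhdsGT hε)).and hminors).exists
  refine ⟨δ, hδ.1, fun a b hab hpB hBΩ hsize => ?_⟩
  have hdist : ∀ x ∈ Set.Icc a b, dist x p < δ := fun x hx =>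
    (dist_pi_lt_iff hδ.1).mpr fun i => (Real.dist_le_of_mem_Icc ⟨hx.1 i, hx.2 i⟩
      ⟨hpB.1 i, hpB.2 i⟩).trans_lt (hsize i)
  have hmid : (fun i => (a i + b i) / 2) ∈ Set.Icc a b :=
    ⟨fun i => by linarith [hab i], fun i => by linarith [hab i]⟩
  refine ⟨(Matrix.isUnit_iff_isUnit_det _).mpr
    (isUnit_iff_ne_zero.mpr (hunit ((hdist _ hmid).trans hδ.2))), ?_⟩
  intro k hk c hc q hq
  have hdiff : ∀ j l, DifferentiableAt ℝ (f l) (q j) := fun j l =>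
    ((hC1 l).contDiffAt (hΩ.mem_nhds (hBΩ (hq j)))).differentiableAt one_ne_zero
  convert hδm ⟨k, hk⟩ c hc _ q (hdist _ hmid) fun j => hdist _ (hq j) using 5 with j l
  exact pd_sum_mul _ (hdiff j) (c l)
end
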